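/- arXiv:2008.08734 — 2 statements merged into one kernel-verified Lean document; each statement's English description precedes it below -/
import Mathlib

section
/- Let A, C ∈ ℝ^{n×n}, B, D ∈ ℝ^{n×m} and L ∈ ℝ^{m×n}, and set M_L = (A+BL)⊗(A+BL) + (C+DL)⊗(C+DL). Then ρ(M_L) < 1 if and only if for every symmetric positive definite matrix F ∈ ℝ^{n×n} there exists a unique symmetric positive definite matrix P ∈ ℝ^{n×n} satisfying P = (A+BL)ᵀP(A+BL) + (C+DL)ᵀP(C+DL) + F. -/
open Matrix Kronecker

/-- The spectral radius of a real square matrix: the maximum modulus of its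
complex eigenvalues. -/
noncomputable def specRad {ι : Type*} [Fintype ι] [DecidableEq ι]
    (M : Matrix ι ι ℝ) : ℝ :=
  sSup ((fun μ : ℂ => ‖μ‖) '' spectrum ℂ (M.map Complex.ofReal))

open Filter Topology

section SpectralRadius

variable {ι : Type*} [Fintype ι] [DecidableEq ι]

theorem specRad_lt_one_iff (M : Matrix ι ι ℝ) :
    specRad M < 1 ↔ ∀ μ ∈ spectrum ℂ (M.map Complex.ofReal), ‖μ‖ < 1 := by
  have hfin : ((fun μ : ℂ => ‖μ‖) '' spectrum ℂ (M.map Complex.ofReal)).Finite :=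
    (Matrix.finite_spectrum _).image _
  constructor
  · intro h μ hμ
    exact (le_csSup hfin.bddAbove ⟨μ, hμ, rfl⟩).trans_lt h
  · intro h
    unfold specRad
    rcases (spectrum ℂ (M.map Complex.ofReal)).eq_empty_or_nonempty with he | hne
    · simp [he]
    · rw [hfin.csSup_lt_iff (hne.image _)]
      rintro _ ⟨μ, hμ, rfl⟩
      exact h μ hμ

/-- In a complex Banach algebra, the powers of an element of spectral radius less than one
tend to zero. -/
theorem tendsto_pow_zero_of_spectralRadius_lt_one {E : Type*} [NormedRing E] [NormedAlgebra ℂ E]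
    [CompleteSpace E] (a : E) (h : spectralRadius ℂ a < 1) :
    Tendsto (fun k : ℕ => a ^ k) atTop (𝓝 0) := by
  obtain ⟨r, hr, hr1⟩ := ENNReal.lt_iff_exists_nnreal_btwn.1 h
  have hev := (spectrum.pow_nnnorm_pow_one_div_tendsto_nhds_spectralRadius a).eventually_lt_const hr
  have hr1' : r < 1 := by exact_mod_cast hr1
  refine squeeze_zero_norm' ?_ (tendsto_pow_atTop_nhds_zero_of_lt_one r.2 hr1')
  filter_upwards [hev, eventually_gt_atTop 0] with k hk hk0
  have hk0' : (0 : ℝ) < k := by exact_mod_cast hk0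
  have h2 := (ENNReal.rpow_lt_rpow hk hk0').le
  rw [← ENNReal.rpow_mul, one_div, inv_mul_cancel₀ hk0'.ne', ENNReal.rpow_one,
    ENNReal.rpow_natCast] at h2
  exact_mod_cast h2

attribute [local instance] Matrix.linftyOpNormedRing Matrix.linftyOpNormedAlgebra in
theorem tendsto_pow_apply_zero_of_specRad_lt_one (M : Matrix ι ι ℝ) (h : specRad M < 1) (i j : ι) :
    Tendsto (fun k : ℕ => (M ^ k) i j) atTop (𝓝 0) := by
  have hsr : spectralRadius ℂ (M.map Complex.ofReal) < 1 := by
    refine lt_of_le_of_lt (b := ENNReal.ofReal (specRad M)) ?_ (by simpa using h)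
    refine iSup₂_le fun μ hμ => ?_
    have := le_csSup ((Matrix.finite_spectrum (M.map Complex.ofReal)).image
      (fun μ : ℂ => ‖μ‖)).bddAbove ⟨μ, hμ, rfl⟩
    rw [← enorm_eq_nnnorm, ← ofReal_norm]
    exact ENNReal.ofReal_le_ofReal this
  have hlim := tendsto_pow_zero_of_spectralRadius_lt_one _ hsr
  have hentry : Tendsto (fun k : ℕ => ((M.map Complex.ofReal) ^ k) i j) atTop (𝓝 0) := by
    have hc : Continuous fun N : Matrix ι ι ℂ => N i j := by fun_prop
    exact (hc.tendsto 0).comp hlim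
  have hmap (k : ℕ) : ((M.map Complex.ofReal) ^ k) i j = ((M ^ k) i j : ℂ) := by
    have := map_pow (Complex.ofRealHom.mapMatrix (m := ι)) M k
    exact (congrFun (congrFun this i) j).symm
  simp only [hmap] at hentry
  exact (Complex.continuous_re.tendsto 0).comp hentry

end SpectralRadius

section Lyapunov

variable {ι R : Type*} [Fintype ι] [CommRing R]

/-- The generalized Lyapunov operator `Z ↦ XᵀZX + YᵀZY`. -/
def lyapunovOp (X Y Z : Matrix ι ι R) : Matrix ι ι R := Xᵀ * Z * X + Yᵀ * Z * Y

theorem vec_vecMul_kronecker_add (X Y Z : Matrix ι ι R) :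
    Z.vec ᵥ* (X ⊗ₖ X + Y ⊗ₖ Y) = (lyapunovOp X Y Z).vec := by
  rw [Matrix.vecMul_add, vec_vecMul_kronecker, vec_vecMul_kronecker, lyapunovOp, vec_add]

theorem vec_vecMul_kronecker_add_pow [DecidableEq ι] (X Y Z : Matrix ι ι R) (k : ℕ) :
    Z.vec ᵥ* (X ⊗ₖ X + Y ⊗ₖ Y) ^ k = ((lyapunovOp X Y)^[k] Z).vec := by
  induction k with
  | zero => simp
  | succ k ih =>
    rw [pow_succ, ← vecMul_vecMul, ih, vec_vecMul_kronecker_add, Function.iterate_succ_apply']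

theorem lyapunovOp_transpose (X Y Z : Matrix ι ι R) :
    lyapunovOp X Y Zᵀ = (lyapunovOp X Y Z)ᵀ := by
  simp [lyapunovOp, Matrix.mul_assoc]

theorem lyapunovOp_sub (X Y Z W : Matrix ι ι R) :
    lyapunovOp X Y (Z - W) = lyapunovOp X Y Z - lyapunovOp X Y W := by
  simp only [lyapunovOp, Matrix.mul_sub, Matrix.sub_mul]
  abel

theorem dotProduct_lyapunovOp_mulVec (X Y Z : Matrix ι ι R) (u v : ι → R) :
    u ⬝ᵥ (lyapunovOp X Y Z *ᵥ v) =
      (X *ᵥ u) ⬝ᵥ (Z *ᵥ (X *ᵥ v)) + (Y *ᵥ u) ⬝ᵥ (Z *ᵥ (Y *ᵥ v)) := by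
  simp only [lyapunovOp, add_mulVec, dotProduct_add, ← mulVec_mulVec]
  congr 1 <;> rw [dotProduct_mulVec, vecMul_transpose]

theorem Matrix.PosSemidef.lyapunovOp {P : Matrix ι ι ℝ} (hP : P.PosSemidef) (X Y : Matrix ι ι ℝ) :
    (lyapunovOp X Y P).PosSemidef := by
  have h (Z : Matrix ι ι ℝ) : (Zᵀ * P * Z).PosSemidef := by
    simpa using hP.conjTranspose_mul_mul_same Z
  exact (h X).add (h Y)

theorem existsUnique_eq_lyapunovOp_add [DecidableEq ι] (X Y : Matrix ι ι ℝ)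
    (h : specRad (X ⊗ₖ X + Y ⊗ₖ Y) < 1) (F : Matrix ι ι ℝ) :
    ∃! P, P = lyapunovOp X Y P + F := by
  set M := X ⊗ₖ X + Y ⊗ₖ Y with hM
  have hunit : IsUnit (1 - M).det := by
    have h1 : (1 : ℂ) ∉ spectrum ℂ (M.map Complex.ofReal) := fun h1 => by
      simpa using (specRad_lt_one_iff M).1 h 1 h1
    rw [spectrum.notMem_iff, map_one, Matrix.isUnit_iff_isUnit_det] at h1
    have h2 : (1 - M.map Complex.ofReal) = Complex.ofRealHom.mapMatrix (1 - M) := by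
      rw [map_sub, map_one]; rfl
    rw [h2, ← RingHom.map_det] at h1
    simpa using h1
  have key (P : Matrix ι ι ℝ) : P = lyapunovOp X Y P + F ↔ P.vec ᵥ* (1 - M) = F.vec := by
    rw [Matrix.vecMul_sub, vecMul_one, hM, vec_vecMul_kronecker_add, ← vec_sub, vec_inj,
      sub_eq_iff_eq_add']
  obtain ⟨P, hP⟩ := vec_bijective.surjective (F.vec ᵥ* (1 - M)⁻¹)
  refine ⟨P, (key P).2 ?_, fun Q hQ => vec_inj.1 ?_⟩
  · rw [hP, vecMul_vecMul, nonsing_inv_mul _ hunit, vecMul_one]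
  · rw [hP, ← (key Q).1 hQ, vecMul_vecMul, mul_nonsing_inv _ hunit, vecMul_one]

theorem posDef_of_eq_lyapunovOp_add [DecidableEq ι] {X Y F P : Matrix ι ι ℝ}
    (h : specRad (X ⊗ₖ X + Y ⊗ₖ Y) < 1) (hF : F.PosDef) (hP : P = lyapunovOp X Y P + F) :
    P.PosDef := by
  have hsymm : Pᵀ = P := by
    refine (existsUnique_eq_lyapunovOp_add X Y h F).unique ?_ hP
    have hFt : Fᵀ = F := by simpa using hF.isHermitian.eq
    rw [lyapunovOp_transpose]
    conv_lhs => rw [hP]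
    rw [transpose_add, hFt]
  have hdiff (k : ℕ) : (P - (lyapunovOp X Y)^[k] P).PosSemidef := by
    induction k with
    | zero => simpa using Matrix.PosSemidef.zero
    | succ k ih =>
      have : P - (lyapunovOp X Y)^[k + 1] P
          = lyapunovOp X Y (P - (lyapunovOp X Y)^[k] P) + F := by
        rw [Function.iterate_succ_apply', lyapunovOp_sub]
        nth_rewrite 1 [hP]
        abel
      rw [this]
      exact (ih.lyapunovOp X Y).add hF.posSemidef
  have hlim (i j : ι) : Tendsto (fun k => (lyapunovOp X Y)^[k] P i j) atTop (𝓝 0) := by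
    have hk (k : ℕ) : (lyapunovOp X Y)^[k] P i j
        = ∑ p, P.vec p * ((X ⊗ₖ X + Y ⊗ₖ Y) ^ k) p (j, i) :=
      (congrFun (vec_vecMul_kronecker_add_pow X Y P k) (j, i)).symm
    simp only [hk]
    rw [show (0 : ℝ) = ∑ p : ι × ι, P.vec p * 0 by simp]
    exact tendsto_finsetSum _ fun p _ =>
      (tendsto_pow_apply_zero_of_specRad_lt_one _ h p (j, i)).const_mul _
  have hpsd : P.PosSemidef := by
    refine .of_dotProduct_mulVec_nonneg (by simpa [IsHermitian] using hsymm) fun x => ?_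
    have hl : Tendsto (fun k => star x ⬝ᵥ ((P - (lyapunovOp X Y)^[k] P) *ᵥ x)) atTop
        (𝓝 (star x ⬝ᵥ ((P - 0) *ᵥ x))) := by
      simp only [dotProduct, mulVec, Matrix.sub_apply, Matrix.zero_apply]
      exact tendsto_finsetSum _ fun i _ => (tendsto_finsetSum _ fun j _ =>
        ((hlim i j).const_sub _).mul_const _).const_mul _
    rw [sub_zero] at hl
    exact ge_of_tendsto' hl fun k => (hdiff k).dotProduct_mulVec_nonneg x
  rw [hP]
  exact Matrix.PosDef.posSemidef_add (hpsd.lyapunovOp X Y) hF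

theorem norm_dotProduct_mulVec_le (Z : Matrix ι ι ℂ) (u v : ι → ℝ) :
    ‖(Complex.ofReal ∘ u) ⬝ᵥ (Z *ᵥ (Complex.ofReal ∘ v))‖
      ≤ (∑ i, ∑ j, ‖Z i j‖) * (√(u ⬝ᵥ u) * √(v ⬝ᵥ v)) := by
  have habs (w : ι → ℝ) (i : ι) : |w i| ≤ √(w ⬝ᵥ w) := by
    refine Real.abs_le_sqrt ?_
    rw [sq]
    exact Finset.single_le_sum (f := fun i => w i * w i) (fun j _ => mul_self_nonneg _)
      (Finset.mem_univ i)
  simp only [dotProduct, mulVec, Finset.mul_sum, Finset.sum_mul, Function.comp_apply]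
  refine (norm_sum_le _ _).trans (Finset.sum_le_sum fun i _ => (norm_sum_le _ _).trans
    (Finset.sum_le_sum fun j _ => ?_))
  rw [norm_mul, norm_mul, Complex.norm_real, Complex.norm_real, Real.norm_eq_abs, Real.norm_eq_abs]
  calc |u i| * (‖Z i j‖ * |v j|) = ‖Z i j‖ * (|u i| * |v j|) := by ring
    _ ≤ _ := by
      gcongr
      · exact habs u i
      · exact habs v j

theorem Real.sqrt_mul_sqrt_add_sqrt_mul_sqrt_le {a b c d s t : ℝ} (ha : 0 ≤ a) (hb : 0 ≤ b)
    (hc : 0 ≤ c) (hd : 0 ≤ d) (hs : a + b ≤ s) (ht : c + d ≤ t) :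
    √a * √c + √b * √d ≤ √s * √t := by
  rw [← Real.sqrt_mul (x := s) (by linarith)]
  refine Real.le_sqrt_of_sq_le (le_trans ?_ (mul_le_mul hs ht (by positivity) (by linarith)))
  nlinarith [sq_nonneg (√a * √d - √b * √c), Real.sq_sqrt ha, Real.sq_sqrt hb, Real.sq_sqrt hc,
    Real.sq_sqrt hd, mul_pow √a √c 2, mul_pow √b √d 2, mul_pow √a √d 2, mul_pow √b √c 2]

theorem ofReal_comp_mulVec (X : Matrix ι ι ℝ) (u : ι → ℝ) :
    X.map Complex.ofReal *ᵥ (Complex.ofReal ∘ u) = Complex.ofReal ∘ (X *ᵥ u) := by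
  ext i
  simp [mulVec, dotProduct]

theorem norm_lt_one_of_lyapunovOp_eq_smul [DecidableEq ι] {X Y P : Matrix ι ι ℝ} (hP : P.PosDef)
    (hPeq : P = lyapunovOp X Y P + 1) {Z : Matrix ι ι ℂ} (hZ : Z ≠ 0) {μ : ℂ}
    (hμ : lyapunovOp (X.map Complex.ofReal) (Y.map Complex.ofReal) Z = μ • Z) : ‖μ‖ < 1 := by
  set q : (ι → ℝ) → ℝ := fun u => u ⬝ᵥ (P *ᵥ u) with hq
  set b : (ι → ℝ) → (ι → ℝ) → ℂ :=
    fun u v => (Complex.ofReal ∘ u) ⬝ᵥ (Z *ᵥ (Complex.ofReal ∘ v)) with hb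
  have hq0 (u : ι → ℝ) : 0 ≤ q u := by simpa using hP.posSemidef.dotProduct_mulVec_nonneg u
  have hqeq (u : ι → ℝ) : q u = q (X *ᵥ u) + q (Y *ᵥ u) + u ⬝ᵥ u := by
    simp only [hq]
    rw [← dotProduct_lyapunovOp_mulVec]
    conv_lhs => rw [hPeq]
    rw [add_mulVec, dotProduct_add, one_mulVec]
  have hle (u : ι → ℝ) : u ⬝ᵥ u ≤ q u := by linarith [hqeq u, hq0 (X *ᵥ u), hq0 (Y *ᵥ u)]
  have hdot0 (u : ι → ℝ) : 0 ≤ u ⬝ᵥ u := Finset.sum_nonneg fun i _ => mul_self_nonneg _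
  obtain ⟨K, hK, hqK⟩ : ∃ K : ℝ, 1 ≤ K ∧ ∀ u, q u ≤ K * (u ⬝ᵥ u) := by
    refine ⟨1 + ∑ i, ∑ j, ‖(P.map Complex.ofReal) i j‖, ?_, fun u => ?_⟩
    · have : 0 ≤ ∑ i, ∑ j, ‖(P.map Complex.ofReal) i j‖ := by positivity
      linarith
    · have h1 := norm_dotProduct_mulVec_le (P.map Complex.ofReal) u u
      have h2 : (Complex.ofReal ∘ u) ⬝ᵥ (P.map Complex.ofReal *ᵥ (Complex.ofReal ∘ u))
          = (q u : ℂ) := by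
        rw [ofReal_comp_mulVec]
        simp [hq, dotProduct]
      rw [h2, Complex.norm_real, Real.mul_self_sqrt (hdot0 u)] at h1
      linarith [Real.le_norm_self (q u), hdot0 u]
  set r : ℝ := 1 - K⁻¹ with hr
  have hKpos : 0 < K := by linarith
  have hr0 : 0 ≤ r := sub_nonneg.2 (inv_le_one_of_one_le₀ hK)
  have hr1 : r < 1 := sub_lt_self _ (inv_pos.2 hKpos)
  have hcontr (u : ι → ℝ) : q (X *ᵥ u) + q (Y *ᵥ u) ≤ r * q u := by
    have : K⁻¹ * q u ≤ u ⬝ᵥ u := by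
      rw [inv_mul_le_iff₀ hKpos]; exact hqK u
    rw [hr, sub_mul, one_mul]
    linarith [hqeq u]
  set c : ℝ := ∑ i, ∑ j, ‖Z i j‖ with hc
  have hc0 : 0 ≤ c := by positivity
  have hmul (u v : ι → ℝ) : μ * b u v = b (X *ᵥ u) (X *ᵥ v) + b (Y *ᵥ u) (Y *ᵥ v) := by
    simp only [hb, ← ofReal_comp_mulVec]
    rw [← dotProduct_lyapunovOp_mulVec, hμ, smul_mulVec, dotProduct_smul, smul_eq_mul]
  have hiter (k : ℕ) : ∀ u v, ‖μ‖ ^ k * ‖b u v‖ ≤ r ^ k * c * (√(q u) * √(q v)) := by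
    induction k with
    | zero =>
      intro u v
      have h1 := norm_dotProduct_mulVec_le Z u v
      have h2 : √(u ⬝ᵥ u) * √(v ⬝ᵥ v) ≤ √(q u) * √(q v) := by
        gcongr
        · exact hle u
        · exact hle v
      simpa using h1.trans (mul_le_mul_of_nonneg_left h2 hc0)
    | succ k ih =>
      intro u v
      have hcs := Real.sqrt_mul_sqrt_add_sqrt_mul_sqrt_le (hq0 _) (hq0 _) (hq0 _) (hq0 _)
        (hcontr u) (hcontr v)
      rw [Real.sqrt_mul hr0, Real.sqrt_mul hr0] at hcs
      calc ‖μ‖ ^ (k + 1) * ‖b u v‖ = ‖μ‖ ^ k * ‖μ * b u v‖ := by rw [norm_mul]; ring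
        _ ≤ ‖μ‖ ^ k * (‖b (X *ᵥ u) (X *ᵥ v)‖ + ‖b (Y *ᵥ u) (Y *ᵥ v)‖) := by
          rw [hmul]; gcongr; exact norm_add_le _ _
        _ ≤ r ^ k * c * (√(q (X *ᵥ u)) * √(q (X *ᵥ v)) + √(q (Y *ᵥ u)) * √(q (Y *ᵥ v))) := by
          rw [mul_add, mul_add]; exact add_le_add (ih _ _) (ih _ _)
        _ ≤ r ^ k * c * ((√r * √(q u)) * (√r * √(q v))) :=
          mul_le_mul_of_nonneg_left hcs (by positivity)
        _ = r ^ k * (√r * √r) * c * (√(q u) * √(q v)) := by ring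
        _ = r ^ (k + 1) * c * (√(q u) * √(q v)) := by rw [Real.mul_self_sqrt hr0, pow_succ]
  by_contra! hμ1
  have hbzero (u v : ι → ℝ) : b u v = 0 := by
    have hlim : Tendsto (fun k : ℕ => r ^ k * c * (√(q u) * √(q v))) atTop (𝓝 0) := by
      simpa using ((tendsto_pow_atTop_nhds_zero_of_lt_one hr0 hr1).mul_const c).mul_const
        (√(q u) * √(q v))
    refine norm_le_zero_iff.1 (ge_of_tendsto' hlim fun k => le_trans ?_ (hiter k u v))
    exact le_mul_of_one_le_left (norm_nonneg _) (one_le_pow₀ hμ1)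
  refine hZ (Matrix.ext fun i j => ?_)
  have hsingle (i : ι) : Complex.ofReal ∘ (Pi.single i (1 : ℝ) : ι → ℝ) = Pi.single i 1 := by
    ext j
    simp [Pi.single_apply, apply_ite]
  have := hbzero (Pi.single i 1) (Pi.single j 1)
  simpa [hb, hsingle] using this

theorem specRad_lt_one_of_posDef_eq_lyapunovOp_add_one [DecidableEq ι] {X Y P : Matrix ι ι ℝ}
    (hP : P.PosDef) (hPeq : P = lyapunovOp X Y P + 1) : specRad (X ⊗ₖ X + Y ⊗ₖ Y) < 1 := by
  rw [specRad_lt_one_iff]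
  intro μ hμ
  have hmap : (X ⊗ₖ X + Y ⊗ₖ Y).map Complex.ofReal
      = X.map Complex.ofReal ⊗ₖ X.map Complex.ofReal
        + Y.map Complex.ofReal ⊗ₖ Y.map Complex.ofReal := by
    ext
    simp
  rw [hmap, spectrum.mem_iff, Matrix.isUnit_iff_isUnit_det, isUnit_iff_ne_zero, not_not,
    ← exists_vecMul_eq_zero_iff] at hμ
  obtain ⟨z, hz, hzeq⟩ := hμ
  obtain ⟨Z, rfl⟩ := vec_bijective.surjective z
  rw [Matrix.vecMul_sub, vec_vecMul_kronecker_add, Algebra.algebraMap_eq_smul_one, vecMul_smul,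
    vecMul_one, ← vec_smul, sub_eq_zero, vec_inj] at hzeq
  exact norm_lt_one_of_lyapunovOp_eq_smul hP hPeq (by simpa using hz) hzeq.symm

end Lyapunov

theorem stmt1 {n m : ℕ} (A C : Matrix (Fin n) (Fin n) ℝ)
    (B D : Matrix (Fin n) (Fin m) ℝ) (L : Matrix (Fin m) (Fin n) ℝ) :
    specRad ((A + B * L) ⊗ₖ (A + B * L) + (C + D * L) ⊗ₖ (C + D * L)) < 1 ↔
    ∀ F : Matrix (Fin n) (Fin n) ℝ, F.PosDef →
      ∃! P : Matrix (Fin n) (Fin n) ℝ, P.PosDef ∧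
        P = (A + B * L)ᵀ * P * (A + B * L) + (C + D * L)ᵀ * P * (C + D * L) + F := by
  constructor
  · intro h F hF
    obtain ⟨P, hP, huniq⟩ := existsUnique_eq_lyapunovOp_add _ _ h F
    exact ⟨P, ⟨posDef_of_eq_lyapunovOp_add h hF hP, hP⟩, fun Q hQ => huniq Q hQ.2⟩
  · intro h
    obtain ⟨P, ⟨hP, hPeq⟩, -⟩ := h 1 Matrix.PosDef.one
    exact specRad_lt_one_of_posDef_eq_lyapunovOp_add_one hP hPeq
end

section
/- Let A, C ∈ ℝ^{n×n}, B, D ∈ ℝ^{n×m}, L ∈ ℝ^{m×n}, let Q ∈ ℝ^{n×n} and R ∈ ℝ^{m×m} be symmetric positive definite, and let γ ∈ [0,1). Suppose P ∈ ℝ^{n×n} is a symmetric positive definite matrix satisfying the discounted stochastic Lyapunov equation P = γ(A+BL)ᵀP(A+BL) + γ(C+DL)ᵀP(C+DL) + LᵀRL + Q, and suppose in addition that Q + LᵀRL − (1−γ)P is positive definite. Then ρ(M_L) < 1, where M_L = (A+BL)⊗(A+BL) + (C+DL)⊗(C+DL). -/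
open Matrix Kronecker

open Filter Topology

/-- A real positive definite quadratic form dominates a multiple of the squared norm. -/
lemma Matrix.PosDef.exists_mul_sq_norm_le {ι : Type*} [Fintype ι] {W : Matrix ι ι ℝ}
    (hW : W.PosDef) : ∃ δ : ℝ, 0 < δ ∧ ∀ x : ι → ℝ, δ * ‖x‖ ^ 2 ≤ x ⬝ᵥ W *ᵥ x := by
  have hcont : Continuous fun x : ι → ℝ => x ⬝ᵥ W *ᵥ x := by fun_prop
  rcases (Metric.sphere (0 : ι → ℝ) 1).eq_empty_or_nonempty with he | hne
  · refine ⟨1, one_pos, fun x => ?_⟩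
    by_cases hx : x = 0
    · simp [hx]
    · have : (‖x‖⁻¹ • x) ∈ Metric.sphere (0 : ι → ℝ) 1 := by
        simp [norm_smul, inv_mul_cancel₀ (norm_ne_zero_iff.2 hx)]
      simp [he] at this
  · obtain ⟨z, hz, hmin⟩ := (isCompact_sphere (0 : ι → ℝ) 1).exists_isMinOn hne hcont.continuousOn
    have hz0 : z ≠ 0 := by
      rintro rfl
      simp at hz
    refine ⟨z ⬝ᵥ W *ᵥ z, by simpa using hW.dotProduct_mulVec_pos hz0, fun x => ?_⟩
    by_cases hx : x = 0
    · simp [hx]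
    · have hn : 0 < ‖x‖ := norm_pos_iff.2 hx
      have hmem : (‖x‖⁻¹ • x) ∈ Metric.sphere (0 : ι → ℝ) 1 := by
        simp [norm_smul, inv_mul_cancel₀ hn.ne']
      have h : z ⬝ᵥ W *ᵥ z ≤ (‖x‖⁻¹ • x) ⬝ᵥ W *ᵥ (‖x‖⁻¹ • x) := hmin hmem
      rw [mulVec_smul, smul_dotProduct, dotProduct_smul, smul_eq_mul, smul_eq_mul] at h
      calc (z ⬝ᵥ W *ᵥ z) * ‖x‖ ^ 2
          ≤ (‖x‖⁻¹ * (‖x‖⁻¹ * (x ⬝ᵥ W *ᵥ x))) * ‖x‖ ^ 2 := by gcongr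
        _ = x ⬝ᵥ W *ᵥ x := by field_simp

/-- The pairing of a complex vector on `ι × ι` with the pure tensor of two real vectors. -/
noncomputable def tensorPairing {ι : Type*} [Fintype ι] (v : ι × ι → ℂ) (x y : ι → ℝ) : ℂ :=
  v ⬝ᵥ fun p => (x p.1 : ℂ) * y p.2

lemma norm_tensorPairing_le {ι : Type*} [Fintype ι] (v : ι × ι → ℂ) (x y : ι → ℝ) :
    ‖tensorPairing v x y‖ ≤ (∑ p, ‖v p‖) * (‖x‖ * ‖y‖) := by
  rw [tensorPairing, dotProduct, Finset.sum_mul]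
  refine (norm_sum_le _ _).trans (Finset.sum_le_sum fun p _ => ?_)
  rw [norm_mul, norm_mul, Complex.norm_real, Complex.norm_real]
  gcongr
  · exact norm_le_pi_norm x p.1
  · exact norm_le_pi_norm y p.2

lemma tensorPairing_single {ι : Type*} [Fintype ι] [DecidableEq ι] (v : ι × ι → ℂ) (p : ι × ι) :
    tensorPairing v (Pi.single p.1 1) (Pi.single p.2 1) = v p := by
  rw [tensorPairing, dotProduct, Finset.sum_eq_single p]
  · simp
  · rintro ⟨i, j⟩ - hne
    by_cases hi : i = p.1
    · have hj : j ≠ p.2 := fun hj => hne (Prod.ext hi hj)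
      simp [Pi.single_apply, hj]
    · simp [Pi.single_apply, hi]
  · simp

lemma kronecker_map_mulVec_tensor {ι : Type*} [Fintype ι] (F : Matrix ι ι ℝ) (x y : ι → ℝ) :
    ((F ⊗ₖ F).map Complex.ofReal *ᵥ fun p => (x p.1 : ℂ) * y p.2) =
      fun p => ((F *ᵥ x) p.1 : ℂ) * (F *ᵥ y) p.2 := by
  ext p
  simp only [mulVec, dotProduct, map_apply, kroneckerMap_apply, Complex.ofReal_mul,
    Complex.ofReal_sum, Fintype.sum_prod_type, Finset.sum_mul_sum]
  refine Finset.sum_congr rfl fun i _ => Finset.sum_congr rfl fun j _ => ?_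
  ring

lemma tensorPairing_mulVec_add {ι : Type*} [Fintype ι] (F G : Matrix ι ι ℝ) (v : ι × ι → ℂ)
    (μ : ℂ) (hv : v ᵥ* (F ⊗ₖ F + G ⊗ₖ G).map Complex.ofReal = μ • v) (x y : ι → ℝ) :
    μ * tensorPairing v x y =
      tensorPairing v (F *ᵥ x) (F *ᵥ y) + tensorPairing v (G *ᵥ x) (G *ᵥ y) := by
  simp only [tensorPairing]
  rw [← smul_eq_mul, ← smul_dotProduct, ← hv, ← dotProduct_mulVec,
    Matrix.map_add _ Complex.ofReal_add, add_mulVec, kronecker_map_mulVec_tensor,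
    kronecker_map_mulVec_tensor, dotProduct_add]

lemma exists_vecMul_eq_smul_of_mem_spectrum {ι : Type*} [Fintype ι] [DecidableEq ι]
    {M : Matrix ι ι ℂ} {μ : ℂ} (hμ : μ ∈ spectrum ℂ M) : ∃ v ≠ 0, v ᵥ* M = μ • v := by
  rw [spectrum.mem_iff, isUnit_iff_isUnit_det, isUnit_iff_ne_zero, not_not,
    ← exists_vecMul_eq_zero_iff] at hμ
  obtain ⟨v, hv0, hv⟩ := hμ
  refine ⟨v, hv0, ?_⟩
  rw [vecMul_sub, sub_eq_zero, Algebra.algebraMap_eq_smul_one, vecMul_smul, vecMul_one] at hv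
  exact hv.symm

/-- A strict contraction of a positive definite quadratic form by the pair `F`, `G` forces the
eigenvalues of `F ⊗ F + G ⊗ G` into the open unit disc. -/
lemma norm_lt_one_of_mem_spectrum_kronecker {ι : Type*} [Fintype ι] [DecidableEq ι]
    {F G P W : Matrix ι ι ℝ} (hP : P.PosDef) (hW : W.PosDef)
    (h : ∀ x : ι → ℝ, (F *ᵥ x) ⬝ᵥ P *ᵥ (F *ᵥ x) + (G *ᵥ x) ⬝ᵥ P *ᵥ (G *ᵥ x) + x ⬝ᵥ W *ᵥ x =
      x ⬝ᵥ P *ᵥ x)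
    {μ : ℂ} (hμ : μ ∈ spectrum ℂ ((F ⊗ₖ F + G ⊗ₖ G).map Complex.ofReal)) : ‖μ‖ < 1 := by
  obtain ⟨v, hv0, hv⟩ := exists_vecMul_eq_smul_of_mem_spectrum hμ
  by_contra! hμ1
  set q : (ι → ℝ) → ℝ := fun x => x ⬝ᵥ P *ᵥ x with hq
  obtain ⟨ε, hε, hWε⟩ := hW.exists_mul_sq_norm_le
  obtain ⟨δ, hδ, hPδ⟩ := hP.exists_mul_sq_norm_le
  obtain ⟨K, hK, hPK⟩ : ∃ K : ℝ, 0 < K ∧ ∀ x : ι → ℝ, q x ≤ K * ‖x‖ ^ 2 := by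
    refine ⟨(∑ i, ∑ j, |P i j|) + 1, by positivity, fun x => ?_⟩
    have hle : q x ≤ (∑ i, ∑ j, |P i j|) * ‖x‖ ^ 2 := by
      simp only [hq, dotProduct, mulVec, Finset.sum_mul, Finset.mul_sum]
      refine Finset.sum_le_sum fun i _ => Finset.sum_le_sum fun j _ => ?_
      calc x i * (P i j * x j) ≤ |x i * (P i j * x j)| := le_abs_self _
        _ = |P i j| * (‖x i‖ * ‖x j‖) := by
          rw [abs_mul, abs_mul, Real.norm_eq_abs, Real.norm_eq_abs]; ring
        _ ≤ |P i j| * (‖x‖ * ‖x‖) := by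
          gcongr
          · exact norm_le_pi_norm x i
          · exact norm_le_pi_norm x j
        _ = |P i j| * ‖x‖ ^ 2 := by ring
    nlinarith [sq_nonneg ‖x‖]
  obtain ⟨r, hr0, hr1, hr⟩ : ∃ r : ℝ, 0 ≤ r ∧ r < 1 ∧
      ∀ x, q (F *ᵥ x) + q (G *ᵥ x) ≤ r * q x := by
    refine ⟨max 0 (1 - ε / K), le_max_left _ _, max_lt one_pos (by linarith [div_pos hε hK]),
      fun x => ?_⟩
    have hq0 : 0 ≤ q x := (by positivity : 0 ≤ δ * ‖x‖ ^ 2).trans (hPδ x)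
    have h1 : ε / K * q x ≤ x ⬝ᵥ W *ᵥ x :=
      calc ε / K * q x ≤ ε / K * (K * ‖x‖ ^ 2) := by gcongr; exact hPK x
        _ = ε * ‖x‖ ^ 2 := by field_simp
        _ ≤ _ := hWε x
    have h2 : q (F *ᵥ x) + q (G *ᵥ x) + x ⬝ᵥ W *ᵥ x = q x := h x
    calc q (F *ᵥ x) + q (G *ᵥ x) ≤ (1 - ε / K) * q x := by linarith
      _ ≤ _ := by gcongr; exact le_max_right _ _
  set c : ℝ := (∑ p, ‖v p‖) / δ with hc
  have key : ∀ k : ℕ, ∀ x y, ‖tensorPairing v x y‖ ≤ c * r ^ k * (q x + q y) := by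
    intro k
    induction k with
    | zero =>
      intro x y
      have hc0 : 0 ≤ c := by positivity
      calc ‖tensorPairing v x y‖ ≤ (∑ p, ‖v p‖) * (‖x‖ * ‖y‖) := norm_tensorPairing_le v x y
        _ = c * (δ * (‖x‖ * ‖y‖)) := by rw [hc]; field_simp
        _ ≤ c * (q x + q y) := by
          refine mul_le_mul_of_nonneg_left ?_ hc0
          have h1 : δ * ‖x‖ ^ 2 ≤ q x := hPδ x
          have h2 : δ * ‖y‖ ^ 2 ≤ q y := hPδ y
          nlinarith [mul_nonneg hδ.le (sq_nonneg (‖x‖ - ‖y‖)),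
            mul_nonneg hδ.le (mul_nonneg (norm_nonneg x) (norm_nonneg y))]
        _ = _ := by ring
    | succ k ih =>
      intro x y
      calc ‖tensorPairing v x y‖ ≤ ‖μ‖ * ‖tensorPairing v x y‖ :=
            le_mul_of_one_le_left (norm_nonneg _) hμ1
        _ = ‖tensorPairing v (F *ᵥ x) (F *ᵥ y) + tensorPairing v (G *ᵥ x) (G *ᵥ y)‖ := by
          rw [← norm_mul, tensorPairing_mulVec_add F G v μ hv]
        _ ≤ c * r ^ k * (q (F *ᵥ x) + q (F *ᵥ y)) + c * r ^ k * (q (G *ᵥ x) + q (G *ᵥ y)) :=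
          (norm_add_le _ _).trans (add_le_add (ih _ _) (ih _ _))
        _ = c * r ^ k * ((q (F *ᵥ x) + q (G *ᵥ x)) + (q (F *ᵥ y) + q (G *ᵥ y))) := by ring
        _ ≤ c * r ^ k * (r * q x + r * q y) := by
          gcongr
          · exact hr x
          · exact hr y
        _ = _ := by ring
  refine hv0 (funext fun p => ?_)
  have hlim : Tendsto (fun k : ℕ => c * r ^ k * (q (Pi.single p.1 1) + q (Pi.single p.2 1)))
      atTop (𝓝 0) := by
    simpa using ((tendsto_pow_atTop_nhds_zero_of_lt_one hr0 hr1).const_mul c).mul_const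
      (q (Pi.single p.1 1) + q (Pi.single p.2 1))
  have hle := ge_of_tendsto' hlim fun k => key k (Pi.single p.1 1) (Pi.single p.2 1)
  rw [tensorPairing_single] at hle
  simpa using hle

lemma specRad_lt_one {ι : Type*} [Fintype ι] [DecidableEq ι] {M : Matrix ι ι ℝ}
    (h : ∀ μ ∈ spectrum ℂ (M.map Complex.ofReal), ‖μ‖ < 1) : specRad M < 1 := by
  rw [specRad]
  rcases ((fun μ : ℂ => ‖μ‖) '' spectrum ℂ (M.map Complex.ofReal)).eq_empty_or_nonempty
    with he | hne
  · simp [he]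
  · rw [((Matrix.finite_spectrum _).image _).csSup_lt_iff hne]
    rintro _ ⟨μ, hμ, rfl⟩
    exact h μ hμ

lemma dotProduct_transpose_mul_mul_mulVec {ι κ : Type*} [Fintype ι] [Fintype κ]
    (F : Matrix κ ι ℝ) (P : Matrix κ κ ℝ) (x : ι → ℝ) :
    x ⬝ᵥ (Fᵀ * P * F) *ᵥ x = (F *ᵥ x) ⬝ᵥ P *ᵥ (F *ᵥ x) := by
  rw [← mulVec_mulVec, ← mulVec_mulVec, dotProduct_mulVec, vecMul_transpose]

theorem stmt4 {n m : ℕ} (A C : Matrix (Fin n) (Fin n) ℝ)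
    (B D : Matrix (Fin n) (Fin m) ℝ) (L : Matrix (Fin m) (Fin n) ℝ)
    (Q : Matrix (Fin n) (Fin n) ℝ) (R : Matrix (Fin m) (Fin m) ℝ) (γ : ℝ)
    (hQ : Q.PosDef) (hR : R.PosDef) (hγ0 : 0 ≤ γ) (hγ1 : γ < 1)
    (P : Matrix (Fin n) (Fin n) ℝ) (hP : P.PosDef)
    (hlyap : P = γ • ((A + B * L)ᵀ * P * (A + B * L)) +
      γ • ((C + D * L)ᵀ * P * (C + D * L)) + Lᵀ * R * L + Q)
    (hgap : (Q + Lᵀ * R * L - (1 - γ) • P).PosDef) :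
    specRad ((A + B * L) ⊗ₖ (A + B * L) + (C + D * L) ⊗ₖ (C + D * L)) < 1 := by
  refine specRad_lt_one fun μ hμ => ?_
  have hquad : ∀ x : Fin n → ℝ,
      γ * (((A + B * L) *ᵥ x) ⬝ᵥ P *ᵥ ((A + B * L) *ᵥ x) +
        ((C + D * L) *ᵥ x) ⬝ᵥ P *ᵥ ((C + D * L) *ᵥ x)) +
        x ⬝ᵥ (Q + Lᵀ * R * L - (1 - γ) • P) *ᵥ x = γ * (x ⬝ᵥ P *ᵥ x) := by
    intro x
    have hx := congrArg (fun N : Matrix (Fin n) (Fin n) ℝ => x ⬝ᵥ N *ᵥ x) hlyap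
    simp only [add_mulVec, sub_mulVec, smul_mulVec, dotProduct_add, dotProduct_sub,
      dotProduct_smul, smul_eq_mul, dotProduct_transpose_mul_mul_mulVec] at hx ⊢
    linarith
  rcases hγ0.eq_or_lt with rfl | hγ
  · obtain ⟨v, hv0, -⟩ := exists_vecMul_eq_smul_of_mem_spectrum hμ
    obtain ⟨p, -⟩ := Function.ne_iff.1 hv0
    have hpos := hgap.dotProduct_mulVec_pos (x := Pi.single p.1 1) (by simp)
    have := hquad (Pi.single p.1 1)
    rw [star_trivial] at hpos
    linarith
  · refine norm_lt_one_of_mem_spectrum_kronecker hP (hgap.smul (inv_pos.2 hγ)) (fun x => ?_) hμ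
    have hx := hquad x
    rw [smul_mulVec, dotProduct_smul, smul_eq_mul]
    field_simp
    linarith
end
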